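/- Let d ≥ 1, 1/2 ≤ s < 1, L₀ ≥ 2, R ≥ 1 and x₀ ∈ ℝ^d. There is a constant C = C(d,s) such that for every function u : ℝ^d → ℝ with |u| ≤ 1 on the ball B_R(x₀) which is Lipschitz on B_R(x₀) with ‖∇u‖_{L^∞(B_R(x₀))} ≤ L₀, one has ∬_{B_R(x₀)×B_R(x₀)} |u(x)−u(y)|² / |x−y|^{d+2s} dy dx ≤ C · L₀^{2s−1} · log(R L₀) · ∫_{B_R(x₀)} |∇u(x)| dx. -/

import Mathlib

open MeasureTheory Metric Set
open scoped ENNReal NNReal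

lemma aux_polar {E : Type*} [NormedAddCommGroup E] [NormedSpace ℝ E] [MeasurableSpace E]
    [Nontrivial E] (μ : Measure E) [FiniteDimensional ℝ E] [BorelSpace E] [μ.IsAddHaarMeasure]
    (f : ℝ → ℝ≥0∞) (hf : Measurable f) :
    ∫⁻ x, f ‖x‖ ∂μ = μ.toSphere univ *
      ∫⁻ y in Ioi (0 : ℝ), ENNReal.ofReal (y ^ (Module.finrank ℝ E - 1)) * f y :=
  calc
    ∫⁻ x, f ‖x‖ ∂μ = ∫⁻ x : ({(0)}ᶜ : Set E), f (‖x.1‖) ∂(μ.comap (↑)) := by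
      rw [lintegral_subtype_comap (measurableSet_singleton _).compl (fun x ↦ f (‖x‖)),
        restrict_compl_singleton]
    _ = ∫⁻ x, f x.2 ∂μ.toSphere.prod (.volumeIoiPow (Module.finrank ℝ E - 1)) := by
      simpa using μ.measurePreserving_homeomorphUnitSphereProd.lintegral_comp_emb
        (Homeomorph.measurableEmbedding _) (f ∘ Subtype.val ∘ Prod.snd)
    _ = μ.toSphere univ * ∫⁻ x : Ioi (0 : ℝ), f x ∂.volumeIoiPow (Module.finrank ℝ E - 1) := by
      rw [lintegral_prod _ (by fun_prop)]
      simp [mul_comm]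
    _ = _ := by
      simp only [Measure.volumeIoiPow]
      rw [lintegral_withDensity_eq_lintegral_mul _ (by fun_prop) (by fun_prop)]
      congr 1
      exact lintegral_subtype_comap measurableSet_Ioi
        fun a ↦ ENNReal.ofReal (a ^ (Module.finrank ℝ E - 1)) * f a

lemma aux_oneD (d : ℕ) (hd : 1 ≤ d) (s : ℝ) (hs0 : 1/2 ≤ s) (hs1 : s < 1) (L R : ℝ)
    (hL : 2 ≤ L) (hR : 1 ≤ R) :
    ∫⁻ y in Ioi (0 : ℝ), ENNReal.ofReal (y ^ (d - 1)) *
      (Iio (2*R)).indicator (fun r => ENNReal.ofReal (min (L * r) 2 * r ^ (1 - (d:ℝ) - 2*s))) y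
    ≤ ENNReal.ofReal ((1/(2-2*s)/Real.log 2 + 4) * L ^ (2*s-1) * Real.log (R*L)) := by
  have hL0 : 0 < L := by linarith
  have hlog2 : 0 < Real.log 2 := Real.log_pos (by norm_num)
  have hRL : 2 ≤ R * L := by nlinarith
  have hlog : Real.log 2 ≤ Real.log (R*L) := Real.log_le_log (by norm_num) hRL
  have hLi : 0 < 1 / L := by positivity
  have hLR : 1 / L ≤ 2 * R := by
    rw [div_le_iff₀ hL0]; nlinarith
  set A : ℝ → ℝ≥0∞ := (Ioc 0 (1/L)).indicator (fun r => ENNReal.ofReal (L * r ^ (1-2*s)))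
  set B : ℝ → ℝ≥0∞ := (Ioc (1/L) (2*R)).indicator
    (fun r => ENNReal.ofReal (2 * L ^ (2*s-1) * r⁻¹))
  have hA : ∫⁻ y, A y = ENNReal.ofReal (L ^ (2*s-1) / (2-2*s)) := by
    rw [lintegral_indicator measurableSet_Ioc]
    have hi : IntervalIntegrable (fun r : ℝ => L * r ^ (1-2*s)) volume 0 (1/L) :=
      (intervalIntegral.intervalIntegrable_rpow' (by linarith)).const_mul L
    rw [← ofReal_integral_eq_lintegral_ofReal hi.1]
    · rw [← intervalIntegral.integral_of_le hLi.le, intervalIntegral.integral_const_mul,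
        integral_rpow (Or.inl (by linarith)), Real.zero_rpow (by linarith), sub_zero,
        one_div, Real.inv_rpow hL0.le, ← Real.rpow_neg hL0.le]
      congr 1
      have : L ^ (2*s-1) = L * L ^ (-(1 - 2*s+1)) := by
        nth_rewrite 2 [← Real.rpow_one L]
        rw [← Real.rpow_add hL0]; congr 1; ring
      rw [this, mul_div_assoc]; congr 2; ring
    · filter_upwards [ae_restrict_mem measurableSet_Ioc] with y hy
      have := hy.1
      simp only [Pi.zero_apply]
      positivity
  have hB : ∫⁻ y, B y = ENNReal.ofReal (2 * L ^ (2*s-1) * Real.log (2*(R*L))) := by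
    rw [lintegral_indicator measurableSet_Ioc]
    have h0 : (0:ℝ) ∉ uIcc (1/L) (2*R) := by
      rw [uIcc_of_le hLR]; intro h; linarith [h.1]
    have hi : IntervalIntegrable (fun r : ℝ => 2 * L ^ (2*s-1) * r⁻¹) volume (1/L) (2*R) := by
      apply IntervalIntegrable.const_mul
      apply intervalIntegral.intervalIntegrable_inv (fun x hx h => h0 (h ▸ hx)) continuousOn_id
    rw [← ofReal_integral_eq_lintegral_ofReal hi.1]
    · rw [← intervalIntegral.integral_of_le hLR, intervalIntegral.integral_const_mul,
        integral_inv h0]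
      congr 3; field_simp
    · filter_upwards [ae_restrict_mem measurableSet_Ioc] with y hy
      have : 0 < y := hLi.trans hy.1
      simp only [Pi.zero_apply]
      positivity
  have hAm : Measurable A := by
    apply Measurable.indicator _ measurableSet_Ioc; fun_prop
  calc _ ≤ ∫⁻ y in Ioi (0:ℝ), (A y + B y) := by
        apply setLIntegral_mono' measurableSet_Ioi
        intro y (hy : 0 < y)
        by_cases hyR : y < 2 * R
        swap
        · simp [hyR]
        rw [indicator_of_mem (by exact hyR), ← ENNReal.ofReal_mul (by positivity)]
        have e1 : y ^ (d-1) = y ^ ((d:ℝ)-1) := by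
          rw [← Real.rpow_natCast]; congr 1; push_cast [hd]; rfl
        have e2 : y ^ (d-1) * (min (L*y) 2 * y ^ (1-(d:ℝ)-2*s)) = min (L*y) 2 * y ^ (-(2*s)) := by
          rw [e1, mul_left_comm, ← Real.rpow_add hy]; congr 2; ring
        rw [e2]
        by_cases h : y ≤ 1/L
        · refine le_trans ?_ le_self_add
          simp only [A]
          rw [indicator_of_mem (show y ∈ Ioc 0 (1/L) from ⟨hy, h⟩)]
          apply ENNReal.ofReal_le_ofReal
          calc _ ≤ (L*y) * y ^ (-(2*s)) := by gcongr; exact min_le_left _ _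
            _ = L * (y^(1:ℝ) * y ^ (-(2*s))) := by rw [Real.rpow_one]; ring
            _ = _ := by rw [← Real.rpow_add hy]; congr 2
        · push Not at h
          refine le_trans ?_ le_add_self
          simp only [B]
          rw [indicator_of_mem (show y ∈ Ioc (1/L) (2*R) from ⟨h, hyR.le⟩)]
          apply ENNReal.ofReal_le_ofReal
          have : y ^ (-(2*s)) ≤ L ^ (2*s-1) * y⁻¹ := by
            have : y ^ (-(2*s)) = y ^ (-(2*s-1)) * y⁻¹ := by
              rw [← Real.rpow_neg_one, ← Real.rpow_add hy]; congr 1; ring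
            rw [this]; gcongr
            rw [Real.rpow_neg hy.le, ← Real.inv_rpow hy.le]
            apply Real.rpow_le_rpow (by positivity) _ (by linarith)
            rw [inv_le_comm₀ hy hL0]; simpa using h.le
          calc _ ≤ 2 * (L ^ (2*s-1) * y⁻¹) := by
                gcongr; exact min_le_right _ _
            _ = _ := by ring
    _ ≤ ∫⁻ y, (A y + B y) := setLIntegral_le_lintegral _ _
    _ = ENNReal.ofReal (L ^ (2*s-1) / (2-2*s)) +
          ENNReal.ofReal (2 * L ^ (2*s-1) * Real.log (2*(R*L))) := by
        rw [lintegral_add_left hAm, hA, hB]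
    _ ≤ _ := by
        have h2s : 0 < 2 - 2*s := by linarith
        have hl2 : Real.log (2*(R*L)) ≤ 2 * Real.log (R*L) := by
          rw [Real.log_mul (by norm_num) (by positivity)]; linarith
        have hl3 : 0 ≤ Real.log (2*(R*L)) := Real.log_nonneg (by linarith)
        rw [← ENNReal.ofReal_add (by positivity) (by positivity)]
        apply ENNReal.ofReal_le_ofReal
        have hP : 0 < L ^ (2*s-1) := by positivity
        have i1 : L ^ (2*s-1) / (2-2*s) ≤ 1/(2-2*s)/Real.log 2 * L ^ (2*s-1) * Real.log (R*L) := by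
          have : 1/(2-2*s)/Real.log 2 * L ^ (2*s-1) * Real.log (R*L)
            = L ^ (2*s-1) / (2-2*s) * (Real.log (R*L) / Real.log 2) := by field_simp
          rw [this]
          apply le_mul_of_one_le_right (by positivity)
          rwa [one_le_div hlog2]
        have i2 : 2 * L ^ (2*s-1) * Real.log (2*(R*L)) ≤ 4 * L ^ (2*s-1) * Real.log (R*L) := by
          nlinarith
        nlinarith

lemma aux_kernel (d : ℕ) (hd : 1 ≤ d) (s : ℝ) (hs0 : 1/2 ≤ s) (hs1 : s < 1) :
    ∃ C : ℝ, 0 < C ∧ ∀ L R : ℝ, 2 ≤ L → 1 ≤ R →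
      ∫⁻ h in ball (0 : EuclideanSpace ℝ (Fin d)) (2*R),
        ENNReal.ofReal (min (L * ‖h‖) 2 * ‖h‖ ^ (1 - (d:ℝ) - 2*s)) ≤
      ENNReal.ofReal (C * L ^ (2*s-1) * Real.log (R*L)) := by
  have : Nonempty (Fin d) := ⟨⟨0, hd⟩⟩
  have : Nontrivial (EuclideanSpace ℝ (Fin d)) := inferInstance
  set μ : Measure (EuclideanSpace ℝ (Fin d)) := volume
  have hlog2 : 0 < Real.log 2 := Real.log_pos (by norm_num)
  have h2s : 0 < 2 - 2*s := by linarith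
  have hS : 0 < (μ.toSphere univ).toReal := by
    apply ENNReal.toReal_pos
    · simpa using ⟨by omega, (measure_ball_pos volume (0 : EuclideanSpace ℝ (Fin d)) one_pos).ne'⟩
    · exact measure_ne_top _ _
  refine ⟨(μ.toSphere univ).toReal * (1/(2-2*s)/Real.log 2 + 4), by positivity, ?_⟩
  intro L R hL hR
  have key := aux_polar μ ((Iio (2*R)).indicator
    (fun r => ENNReal.ofReal (min (L * r) 2 * r ^ (1 - (d:ℝ) - 2*s))))
    (Measurable.indicator (by fun_prop) measurableSet_Iio)
  rw [finrank_euclideanSpace_fin] at key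
  rw [← lintegral_indicator measurableSet_ball]
  have e : ∀ h : EuclideanSpace ℝ (Fin d), (ball 0 (2*R)).indicator (fun h =>
      ENNReal.ofReal (min (L * ‖h‖) 2 * ‖h‖ ^ (1 - (d:ℝ) - 2*s))) h =
      (Iio (2*R)).indicator
    (fun r => ENNReal.ofReal (min (L * r) 2 * r ^ (1 - (d:ℝ) - 2*s))) ‖h‖ := by
    intro h; simp [indicator]
  simp_rw [e]
  rw [key]
  refine (mul_le_mul_right (aux_oneD d hd s hs0 hs1 L R hL hR) _).trans ?_
  rw [← ENNReal.ofReal_toReal (measure_ne_top μ.toSphere univ), ← ENNReal.ofReal_mul hS.le]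
  apply le_of_eq
  rw [ENNReal.toReal_ofReal hS.le]
  congr 1; ring

section
variable {E : Type*} [NormedAddCommGroup E] [NormedSpace ℝ E] [MeasurableSpace E]
    (μ : Measure E) [FiniteDimensional ℝ E] [BorelSpace E] [μ.IsAddHaarMeasure]

lemma aux_avg (g : E → ℝ≥0∞) (hg : Measurable g) (h : E) :
    ∫⁻ x, (∫⁻ t in Icc (0:ℝ) 1, g (x + t • h)) ∂μ = ∫⁻ x, g x ∂μ := by
  rw [lintegral_lintegral_swap (by fun_prop)]
  simp_rw [lintegral_add_right_eq_self g]
  simp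

lemma aux_line (v : E → ℝ) (K : ℝ≥0) (hv : LipschitzWith K v) (h : E) :
    ∀ᵐ x ∂μ, ENNReal.ofReal |v x - v (x + h)| ≤
      ENNReal.ofReal ‖h‖ * ∫⁻ t in Icc (0:ℝ) 1, ENNReal.ofReal ‖fderiv ℝ v (x + t • h)‖ := by
  have hN : MeasurableSet {x | ¬ DifferentiableAt ℝ v x} :=
    (measurableSet_of_differentiableAt ℝ v).compl
  have h1 := aux_avg μ ({x | ¬ DifferentiableAt ℝ v x}.indicator 1)
    (measurable_one.indicator hN) h
  have h2 : μ {x | ¬ DifferentiableAt ℝ v x} = 0 := hv.ae_differentiableAt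
  rw [lintegral_indicator_one hN, h2, lintegral_eq_zero_iff] at h1
  swap
  · apply Measurable.lintegral_prod_right'
      (f := fun p : E × ℝ => {x | ¬ DifferentiableAt ℝ v x}.indicator (1 : E → ℝ≥0∞) (p.1 + p.2 • h))
    exact (measurable_one.indicator hN).comp (by fun_prop)
  filter_upwards [h1] with x hx
  simp only [Pi.zero_apply] at hx
  rw [lintegral_eq_zero_iff] at hx
  swap
  · exact (measurable_one.indicator hN).comp (by fun_prop)
  have hd : ∀ᵐ t ∂(volume.restrict (Icc (0:ℝ) 1)), DifferentiableAt ℝ v (x + t • h) := by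
    filter_upwards [hx] with t ht
    by_contra hc
    simp [indicator, hc] at ht
  set f : ℝ → ℝ := fun t => v (x + t • h)
  have hl : LipschitzWith K (v) := hv
  have hfl : LipschitzWith (K * ‖h‖₊) f := by
    apply hv.comp
    apply LipschitzWith.of_dist_le_mul
    intro a b
    rw [dist_add_left, dist_eq_norm, ← sub_smul, norm_smul, mul_comm, dist_eq_norm]; simp
  have hac : AbsolutelyContinuousOnInterval f 0 1 :=
    (hfl.lipschitzOnWith).absolutelyContinuousOnInterval
  have ftc := hac.integral_deriv_eq_sub
  have e : |v x - v (x + h)| = ‖∫ t in Icc (0:ℝ) 1, deriv f t‖ := by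
    rw [integral_Icc_eq_integral_Ioc, ← intervalIntegral.integral_of_le zero_le_one, ftc,
      Real.norm_eq_abs, abs_sub_comm]
    simp [f]
  rw [e, ofReal_norm, ← lintegral_const_mul' _ _ (by simp)]
  refine (enorm_integral_le_lintegral_enorm _).trans ?_
  apply lintegral_mono_ae
  filter_upwards [hd] with t ht
  have : HasDerivAt f (fderiv ℝ v (x + t • h) h) t := by
    have h3 : HasDerivAt (fun t : ℝ => x + t • h) h t := by
      simpa using ((hasDerivAt_id t).smul_const h).const_add x
    exact ht.hasFDerivAt.comp_hasDerivAt t h3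
  rw [this.deriv, ← ENNReal.ofReal_mul (by positivity), ← ofReal_norm]
  apply ENNReal.ofReal_le_ofReal
  rw [mul_comm]
  exact ContinuousLinearMap.le_opNorm _ _
end

theorem stmt4 (d : ℕ) (hd : 1 ≤ d) (s : ℝ) (hs0 : 1/2 ≤ s) (hs1 : s < 1) :
    ∃ C : ℝ, 0 < C ∧ ∀ L₀ R : ℝ, 2 ≤ L₀ → 1 ≤ R → ∀ x₀ : EuclideanSpace ℝ (Fin d),
      ∀ u : EuclideanSpace ℝ (Fin d) → ℝ,
        (∀ x ∈ ball x₀ R, |u x| ≤ 1) →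
        LipschitzOnWith (Real.toNNReal L₀) u (ball x₀ R) →
        (∀ᵐ x ∂(volume.restrict (ball x₀ R)), ‖fderiv ℝ u x‖ ≤ L₀) →
        (∫⁻ p : EuclideanSpace ℝ (Fin d) × EuclideanSpace ℝ (Fin d) in
            (ball x₀ R) ×ˢ (ball x₀ R),
            ENNReal.ofReal ((u p.1 - u p.2)^2 / ‖p.1 - p.2‖ ^ ((d : ℝ) + 2*s))) ≤
          ENNReal.ofReal (C * L₀ ^ (2*s - 1) * Real.log (R*L₀) *
            ∫ x in ball x₀ R, ‖fderiv ℝ u x‖) := by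
  obtain ⟨C, hC, hK⟩ := aux_kernel d hd s hs0 hs1
  refine ⟨C, hC, ?_⟩
  intro L R hL hR x₀ u hu1 huL hgrad
  have hL0 : 0 < L := by linarith
  obtain ⟨v, hv, huv⟩ := huL.extend_real
  set B := ball x₀ R
  have hBm : MeasurableSet B := measurableSet_ball
  have hfd : ∀ x ∈ B, fderiv ℝ u x = fderiv ℝ v x := by
    intro x hx
    apply Filter.EventuallyEq.fderiv_eq
    filter_upwards [isOpen_ball.mem_nhds hx] with y hy using huv hy
  set g : EuclideanSpace ℝ (Fin d) → ℝ≥0∞ :=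
    B.indicator (fun x => ENNReal.ofReal ‖fderiv ℝ v x‖) with hg
  have hgm : Measurable g :=
    Measurable.indicator ((measurable_fderiv ℝ v).norm.ennreal_ofReal) hBm
  have hG : ENNReal.ofReal (∫ x in B, ‖fderiv ℝ u x‖) = ∫⁻ x, g x := by
    have hfin : IsFiniteMeasure (volume.restrict B) :=
      ⟨by rw [Measure.restrict_apply_univ]; exact measure_ball_lt_top⟩
    rw [ofReal_integral_eq_lintegral_ofReal, hg, lintegral_indicator hBm]
    · apply setLIntegral_congr_fun hBm
      intro x hx
      simp only [hfd x hx]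
    · apply Integrable.of_bound (C := L)
      · exact (measurable_fderiv ℝ u).norm.aestronglyMeasurable
      · simpa using hgrad
    · exact Filter.Eventually.of_forall fun x => norm_nonneg _
  have hlog : 0 ≤ Real.log (R*L) := Real.log_nonneg (by nlinarith)
  rw [ENNReal.ofReal_mul (by positivity), hG]
  have hvc : Continuous v := hv.continuous
  set F : EuclideanSpace ℝ (Fin d) → EuclideanSpace ℝ (Fin d) → ℝ≥0∞ := fun x h =>
    B.indicator 1 x * (B.indicator 1 (x + h) *
      ENNReal.ofReal ((v x - v (x+h))^2 / ‖h‖ ^ ((d : ℝ) + 2*s))) with hF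
  have hind : Measurable (B.indicator (1 : EuclideanSpace ℝ (Fin d) → ℝ≥0∞)) :=
    measurable_one.indicator hBm
  have hFm : Measurable (Function.uncurry F) := by
    simp only [hF, Function.uncurry_def]
    refine (hind.comp measurable_fst).mul ((hind.comp (by fun_prop)).mul ?_)
    have := hvc.measurable
    fun_prop
  calc _ = ∫⁻ p : EuclideanSpace ℝ (Fin d) × EuclideanSpace ℝ (Fin d) in B ×ˢ B,
            ENNReal.ofReal ((v p.1 - v p.2)^2 / ‖p.1 - p.2‖ ^ ((d : ℝ) + 2*s)) := by
        apply setLIntegral_congr_fun (hBm.prod hBm)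
        intro p hp
        simp only [huv hp.1, huv hp.2]
    _ = ∫⁻ x in B, ∫⁻ y in B,
            ENNReal.ofReal ((v x - v y)^2 / ‖x - y‖ ^ ((d : ℝ) + 2*s)) := by
        rw [Measure.volume_eq_prod, ← Measure.prod_restrict, lintegral_prod]
        have := hvc.measurable
        fun_prop
    _ = ∫⁻ x, ∫⁻ h, F x h := by
        rw [← lintegral_indicator hBm]
        congr 1; ext x
        by_cases hx : x ∈ B
        · simp only [indicator_of_mem hx, hF, Pi.one_apply, one_mul]
          rw [← lintegral_indicator hBm, ← lintegral_add_left_eq_self _ x]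
          congr 1; ext h
          by_cases hh : x + h ∈ B
          · simp [hh]
          · simp [hh]
        · simp [hF, hx]
    _ = ∫⁻ h, ∫⁻ x, F x h := lintegral_lintegral_swap hFm.aemeasurable
    _ ≤ ∫⁻ h : EuclideanSpace ℝ (Fin d), (ball (0 : EuclideanSpace ℝ (Fin d)) (2*R)).indicator (fun h =>
          ENNReal.ofReal (min (L * ‖h‖) 2 * ‖h‖ ^ (1 - (d:ℝ) - 2*s))) h * ∫⁻ x, g x := by
        apply lintegral_mono
        intro h
        simp only
        by_cases hh : h ∈ ball (0 : EuclideanSpace ℝ (Fin d)) (2*R)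
        swap
        · have : ∀ x, F x h = 0 := by
            intro x
            by_cases hx : x ∈ B
            · have : x + h ∉ B := by
                intro hxh
                apply hh
                rw [mem_ball_zero_iff]
                have := dist_triangle_right (x+h) x x₀
                have h1 : dist (x+h) x₀ < R := hxh
                have h2 : dist x x₀ < R := hx
                have h3 : dist (x+h) x = ‖h‖ := by simp [dist_eq_norm]
                linarith
              simp [hF, this]
            · simp [hF, hx]
          simp [this]
        rw [indicator_of_mem hh, ← aux_avg volume g hgm h,
          ← lintegral_const_mul' _ _ (by simp)]
        apply lintegral_mono_ae
        filter_upwards [aux_line volume v _ hv h] with x hx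
        by_cases hxB : x ∈ B
        swap
        · simp [hF, hxB]
        by_cases hxh : x + h ∈ B
        swap
        · simp [hF, hxh]
        simp only [hF, indicator_of_mem hxB, indicator_of_mem hxh, Pi.one_apply, one_mul]
        have e : ∫⁻ t in Icc (0:ℝ) 1, g (x + t • h)
            = ∫⁻ t in Icc (0:ℝ) 1, ENNReal.ofReal ‖fderiv ℝ v (x + t • h)‖ := by
          apply setLIntegral_congr_fun measurableSet_Icc
          intro t ht
          have : x + t • h ∈ B := (convex_ball x₀ R).add_smul_mem hxB hxh ht
          simp only [hg, indicator_of_mem this]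
        rw [e]
        by_cases h0 : h = 0
        · simp [h0]
        have hn : 0 < ‖h‖ := norm_pos_iff.mpr h0
        have hm : |v x - v (x+h)| ≤ min (L * ‖h‖) 2 := by
          apply le_min
          · have := hv.dist_le_mul x (x+h)
            rw [Real.coe_toNNReal _ hL0.le] at this
            simpa [Real.dist_eq] using this
          · have h1 := hu1 x hxB
            have h2 := hu1 _ hxh
            rw [huv hxB] at h1; rw [huv hxh] at h2
            rw [abs_le] at *
            constructor <;> linarith [h1.1, h1.2, h2.1, h2.2]
        calc _ ≤ ENNReal.ofReal ((min (L * ‖h‖) 2 * ‖h‖ ^ (-(d:ℝ) - 2*s)) * |v x - v (x+h)|) := by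
              apply ENNReal.ofReal_le_ofReal
              rw [← sq_abs, div_eq_mul_inv, ← Real.rpow_neg hn.le, sq, neg_add', mul_right_comm]
              gcongr
          _ = ENNReal.ofReal (min (L * ‖h‖) 2 * ‖h‖ ^ (-(d:ℝ) - 2*s)) *
                ENNReal.ofReal |v x - v (x+h)| := ENNReal.ofReal_mul (by positivity)
          _ ≤ _ := mul_le_mul_right hx _
          _ = _ := by
              rw [← mul_assoc, ← ENNReal.ofReal_mul (by positivity)]
              congr 2
              rw [mul_assoc]; congr 1
              rw [← Real.rpow_add_one hn.ne']; congr 1; ring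
    _ = (∫⁻ h in ball (0 : EuclideanSpace ℝ (Fin d)) (2*R),
          ENNReal.ofReal (min (L * ‖h‖) 2 * ‖h‖ ^ (1 - (d:ℝ) - 2*s))) * ∫⁻ x, g x := by
        rw [lintegral_mul_const, lintegral_indicator measurableSet_ball]
        exact Measurable.indicator (by fun_prop) measurableSet_ball
    _ ≤ _ := mul_le_mul_left (hK L R hL hR) _
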